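/- Let r ≥ t be positive integers and let k be an integer with t < k ≤ r. Then msad_k(K_{r,t}) = r + t − k; that is, K_{r,t} has a k-multiset antiresolving set of cardinality r + t − k, and every k-multiset antiresolving set of K_{r,t} has cardinality at least r + t − k. -/

import Mathlib

open Finset

/-- The multiset representation of `v` with respect to `S`:
the multiset of distances from `v` to the vertices of `S`, counted with multiplicity. -/
noncomputable def mrep {V : Type*} (G : SimpleGraph V) (S : Finset V) (v : V) : Multiset ℕ :=
  S.val.map (fun s => G.dist v s)

open scoped Classical in
/-- The set of vertices outside `S` having the same multiset representation as `u`. -/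
noncomputable def mclass {V : Type*} [Fintype V] (G : SimpleGraph V) (S : Finset V)
    (u : V) : Finset V :=
  Finset.univ.filter (fun v => v ∉ S ∧ mrep G S v = mrep G S u)

open scoped Classical in
/-- `S` is a `k`-multiset antiresolving set (`k`-MARS) of `G`: `S` is nonempty, its complement
is nonempty, and `k` is the largest integer such that every vertex `u ∉ S` has at least `k`
vertices outside `S` (including itself) with its same multiset representation. -/
def IsMARS {V : Type*} [Fintype V] (G : SimpleGraph V) (S : Finset V) (k : ℕ) : Prop :=
  S.Nonempty ∧ Sᶜ.Nonempty ∧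
    (∀ u ∉ S, k ≤ (mclass G S u).card) ∧ (∃ u ∉ S, (mclass G S u).card = k)

/-- `msad_k(G) = m`: `G` has a `k`-multiset antiresolving set of cardinality `m`, and every
`k`-multiset antiresolving set of `G` has cardinality at least `m`. -/
def MsadEq {V : Type*} [Fintype V] (G : SimpleGraph V) (k m : ℕ) : Prop :=
  (∃ S : Finset V, IsMARS G S k ∧ S.card = m) ∧
    ∀ S : Finset V, IsMARS G S k → m ≤ S.card

theorem mem_mclass {V : Type*} [Fintype V] {G : SimpleGraph V} {S : Finset V} {u v : V} :
    v ∈ mclass G S u ↔ v ∉ S ∧ mrep G S v = mrep G S u := by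
  simp [mclass]

theorem mrep_congr {V : Type*} {G : SimpleGraph V} {S : Finset V} {u v : V}
    (h : ∀ s ∈ S, G.dist u s = G.dist v s) : mrep G S u = mrep G S v :=
  Multiset.map_congr rfl h

theorem mclass_eq_compl {V : Type*} [Fintype V] [DecidableEq V] {G : SimpleGraph V} {S : Finset V} {u : V}
    (h : ∀ v ∉ S, mrep G S v = mrep G S u) : mclass G S u = Sᶜ := by
  ext v
  rw [mem_mclass, mem_compl]
  exact ⟨And.left, fun hv => ⟨hv, h v hv⟩⟩

theorem IsMARS.of_card_mclass {V : Type*} [Fintype V] {G : SimpleGraph V} {S : Finset V}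
    {k : ℕ} {u : V} (hS : S.Nonempty) (hu : u ∉ S) (h : ∀ v ∉ S, (mclass G S v).card = k) :
    IsMARS G S k :=
  ⟨hS, ⟨u, by simpa using hu⟩, fun v hv => (h v hv).ge, u, hu, h u hu⟩

/-- Distinct nonadjacent vertices with a common neighbour are at distance two. -/
theorem dist_eq_two_of_common_neighbor {V : Type*} {G : SimpleGraph V} {u v w : V}
    (hne : u ≠ v) (hnadj : ¬ G.Adj u v) (huw : G.Adj u w) (hwv : G.Adj w v) :
    G.dist u v = 2 := by
  have hle : G.dist u v ≤ 2 := SimpleGraph.dist_le (.cons huw (.cons hwv .nil))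
  have hpos : 0 < G.dist u v := (huw.reachable.trans hwv.reachable).pos_dist_of_ne hne
  have hone : G.dist u v ≠ 1 := fun h => hnadj (SimpleGraph.dist_eq_one_iff_adj.mp h)
  omega

section CompleteBipartite

variable {α β : Type*} {S : Finset (α ⊕ β)}

theorem mrep_completeBipartiteGraph_inl [Nonempty β] {a b : α} (ha : Sum.inl a ∉ S)
    (hb : Sum.inl b ∉ S) :
    mrep (completeBipartiteGraph α β) S (Sum.inl a) =
      mrep (completeBipartiteGraph α β) S (Sum.inl b) := by
  obtain ⟨w⟩ := ‹Nonempty β›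
  refine mrep_congr fun s hs => ?_
  cases s with
  | inl c =>
    rw [dist_eq_two_of_common_neighbor (w := Sum.inr w) (by rintro h; exact ha (h ▸ hs))
        (by simp) (by simp) (by simp),
      dist_eq_two_of_common_neighbor (w := Sum.inr w) (by rintro h; exact hb (h ▸ hs))
        (by simp) (by simp) (by simp)]
  | inr c =>
    rw [SimpleGraph.dist_eq_one_iff_adj.mpr (by simp),
      SimpleGraph.dist_eq_one_iff_adj.mpr (by simp)]

theorem mrep_completeBipartiteGraph_inr [Nonempty α] {a b : β} (ha : Sum.inr a ∉ S)
    (hb : Sum.inr b ∉ S) :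
    mrep (completeBipartiteGraph α β) S (Sum.inr a) =
      mrep (completeBipartiteGraph α β) S (Sum.inr b) := by
  obtain ⟨w⟩ := ‹Nonempty α›
  refine mrep_congr fun s hs => ?_
  cases s with
  | inl c =>
    rw [SimpleGraph.dist_eq_one_iff_adj.mpr (by simp),
      SimpleGraph.dist_eq_one_iff_adj.mpr (by simp)]
  | inr c =>
    rw [dist_eq_two_of_common_neighbor (w := Sum.inl w) (by rintro h; exact ha (h ▸ hs))
        (by simp) (by simp) (by simp),
      dist_eq_two_of_common_neighbor (w := Sum.inl w) (by rintro h; exact hb (h ▸ hs))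
        (by simp) (by simp) (by simp)]

/-- A set of more than `card β` vertices meets the left part. -/
theorem exists_inl_mem_of_card_lt [Fintype β] {T : Finset (α ⊕ β)} (hT : Fintype.card β < T.card) :
    ∃ a, Sum.inl a ∈ T := by
  by_contra! h
  have hsub : T ⊆ univ.map Function.Embedding.inr := by
    rintro (a | b) hx
    · exact absurd hx (h a)
    · simp
  have hcard := card_le_card hsub
  rw [card_map, card_univ] at hcard
  omega

variable [Fintype α] [Fintype β] [DecidableEq α] [DecidableEq β]

/-- When `k` exceeds the size of the right part, the complement of a `k`-MARS is one class. -/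
theorem IsMARS.card_compl_of_card_lt [Nonempty α] [Nonempty β] {k : ℕ}
    (hk : Fintype.card β < k) (hS : IsMARS (completeBipartiteGraph α β) S k) :
    Sᶜ.card = k := by
  obtain ⟨-, -, hle, u, hu, huk⟩ := hS
  have hcross : ∀ a b, Sum.inl a ∉ S → Sum.inr b ∉ S →
      mrep (completeBipartiteGraph α β) S (Sum.inl a) =
        mrep (completeBipartiteGraph α β) S (Sum.inr b) := by
    intro a b ha hb
    obtain ⟨c, hc⟩ := exists_inl_mem_of_card_lt (hk.trans_le (hle _ hb))
    rw [mem_mclass] at hc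
    exact (mrep_completeBipartiteGraph_inl ha hc.1).trans hc.2
  rw [← huk, mclass_eq_compl]
  intro v hv
  rcases u with a | b <;> rcases v with c | d
  · exact mrep_completeBipartiteGraph_inl hv hu
  · exact (hcross a d hu hv).symm
  · exact hcross c b hv hu
  · exact mrep_completeBipartiteGraph_inr hv hu

/-- The complement of a nonempty set of left vertices is a MARS. -/
theorem isMARS_compl_map_inl [Nonempty β] {A : Finset α} (hA : A.Nonempty) :
    IsMARS (completeBipartiteGraph α β) (A.map Function.Embedding.inl)ᶜ A.card := by
  have hclass : ∀ u ∉ (A.map (Function.Embedding.inl : α ↪ α ⊕ β))ᶜ,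
      (mclass (completeBipartiteGraph α β) (A.map Function.Embedding.inl)ᶜ u).card =
        A.card := by
    intro u hu
    rw [mclass_eq_compl, compl_compl, card_map]
    intro v hv
    rcases u with a | b
    · rcases v with c | d
      · exact mrep_completeBipartiteGraph_inl hv hu
      · simp at hv
    · simp at hu
  obtain ⟨a, ha⟩ := hA
  have hmem : Sum.inl a ∉ (A.map (Function.Embedding.inl : α ↪ α ⊕ β))ᶜ := by simpa using ha
  exact .of_card_mclass ⟨Sum.inr (Classical.arbitrary β), by simp⟩ hmem hclass

end CompleteBipartite

/-- for `r ≥ t ≥ 1` and `t < k ≤ r`, `msad_k(K_{r,t}) = r + t - k`. -/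
theorem stmt7 (r t k : ℕ) (ht : 1 ≤ t) (hrt : t ≤ r) (htk : t < k) (hkr : k ≤ r) :
    MsadEq (completeBipartiteGraph (Fin r) (Fin t)) k (r + t - k) := by
  have : NeZero t := ⟨by omega⟩
  have : NeZero r := ⟨by omega⟩
  constructor
  · obtain ⟨A, -, hA⟩ := exists_subset_card_eq (s := (univ : Finset (Fin r))) (n := k) (by simpa)
    refine ⟨(A.map Function.Embedding.inl)ᶜ, ?_, ?_⟩
    · exact hA ▸ isMARS_compl_map_inl (card_pos.mp (by omega))
    · simp [card_compl, hA]
  · intro S hS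
    have hk := hS.card_compl_of_card_lt (by simpa)
    have hcompl := card_compl_add_card S
    simp only [Fintype.card_sum, Fintype.card_fin] at hcompl
    omega
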